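/- Let n ≥ 2. There exist constants δ > 0 and C > 0, depending only on n, such that every bounded, open, convex set E ⊂ ℝⁿ with P(E) − P(E♯) ≤ δ, where E♯ is a ball with |E♯| = |E|, satisfies A_H^*(E) ≤ C · A_H^♯(E). -/

import Mathlib

open MeasureTheory Metric Set Bornology
open scoped NNReal ENNReal Pointwise symmDiff

noncomputable section

/-- The perimeter of a (convex) set: the `(n-1)`-dimensional Hausdorff measure of its
topological boundary. -/
def perim (n : ℕ) (Ω : Set (EuclideanSpace ℝ (Fin n))) : ℝ :=
  (μH[(n : ℝ) - 1] (frontier Ω)).toReal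

/-- The Rayleigh quotient of `u` on `Ω` with boundary parameter `β`. -/
def rayleigh (n : ℕ) (p β : ℝ) (Ω : Set (EuclideanSpace ℝ (Fin n)))
    (u : EuclideanSpace ℝ (Fin n) → ℝ) : ℝ :=
  ((∫ x in Ω, ‖fderiv ℝ u x‖ ^ p) +
      β * ∫ x in frontier Ω, |u x| ^ p ∂(μH[(n : ℝ) - 1])) /
    ∫ x in Ω, |u x| ^ p

/-- The first Robin eigenvalue of the `p`-Laplacian on `Ω` with boundary parameter `β`. -/
def robinEig (n : ℕ) (p β : ℝ) (Ω : Set (EuclideanSpace ℝ (Fin n))) : ℝ :=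
  sInf { r : ℝ | ∃ u : EuclideanSpace ℝ (Fin n) → ℝ,
    (∃ K : ℝ≥0, LipschitzOnWith K u (closure Ω)) ∧
    (0 < ∫ x in Ω, |u x| ^ p) ∧ r = rayleigh n p β Ω u }

/-- `v` is a first eigenfunction for the Robin `p`-Laplacian on `Ω`: a positive radial
Lipschitz function on the closure of `Ω` whose Rayleigh quotient equals `λ_{p,β}(Ω)`. -/
def IsFirstEigenfunction (n : ℕ) (p β : ℝ) (Ω : Set (EuclideanSpace ℝ (Fin n)))
    (v : EuclideanSpace ℝ (Fin n) → ℝ) : Prop :=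
  (∃ K : ℝ≥0, LipschitzOnWith K v (closure Ω)) ∧
  (∀ x ∈ closure Ω, 0 < v x) ∧
  (∃ h : ℝ → ℝ, ∀ x ∈ closure Ω, v x = h ‖x‖) ∧
  (0 < ∫ x in Ω, |v x| ^ p) ∧
  rayleigh n p β Ω v = robinEig n p β Ω

/-- `ω_n`, the Lebesgue measure of the unit ball of `ℝⁿ`. -/
def unitBallVol (n : ℕ) : ℝ :=
  (volume (ball (0 : EuclideanSpace ℝ (Fin n)) 1)).toReal

/-- The auxiliary function `f(t) = √(t log(1/t))` (relevant on `(0, e⁻¹)`). -/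
def fAux (t : ℝ) : ℝ := Real.sqrt (t * Real.log (1 / t))

/-- The modulus `g` from Fuglede's quantitative isoperimetric inequality. -/
def gFun (n : ℕ) (s : ℝ) : ℝ :=
  if n = 2 then s ^ (2 : ℕ)
  else if n = 3 then Function.invFun fAux (s ^ (2 : ℕ))
  else s ^ (((n : ℝ) + 1) / 2)

/-- Hausdorff asymmetry with respect to balls of the same perimeter. -/
def AHstar (n : ℕ) (E : Set (EuclideanSpace ℝ (Fin n))) : ℝ :=
  sInf { d : ℝ | ∃ (x : EuclideanSpace ℝ (Fin n)) (r : ℝ), 0 < r ∧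
    perim n (ball x r) = perim n E ∧ d = Metric.hausdorffDist E (ball x r) }

/-- Hausdorff asymmetry with respect to balls of the same volume. -/
def AHsharp (n : ℕ) (E : Set (EuclideanSpace ℝ (Fin n))) : ℝ :=
  sInf { d : ℝ | ∃ (x : EuclideanSpace ℝ (Fin n)) (r : ℝ), 0 < r ∧
    volume (ball x r) = volume E ∧ d = Metric.hausdorffDist E (ball x r) }

section ConvexPerimeter

variable {V : Type*} [NormedAddCommGroup V] [InnerProductSpace ℝ V]

/-- A ray issuing from a point of the closure of a bounded set meets the frontier of that set. -/
theorem exists_add_smul_mem_frontier {B : Set V} (hB : IsBounded B) {y v : V}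
    (hy : y ∈ closure B) (hv : v ≠ 0) : ∃ t : ℝ, 0 ≤ t ∧ y + t • v ∈ frontier B := by
  by_contra! H
  set S : Set V := (fun t : ℝ => y + t • v) '' Ici 0
  have hSc : IsPreconnected S :=
    isPreconnected_Ici.image _ (by fun_prop)
  have hyS : y ∈ S := ⟨0, self_mem_Ici, by simp⟩
  have hdisj : ∀ z ∈ S, z ∉ frontier B := by
    rintro _ ⟨t, ht, rfl⟩
    exact H t ht
  have hsub : S ⊆ interior B := by
    refine hSc.subset_left_of_subset_union isOpen_interior
      (isClosed_closure (s := B)).isOpen_compl ?_ ?_ ?_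
    · exact disjoint_compl_right_iff_subset.2 interior_subset_closure
    · intro z hz
      by_cases hzB : z ∈ closure B
      · left
        by_contra hzi
        exact hdisj z hz ⟨hzB, hzi⟩
      · exact Or.inr hzB
    · refine ⟨y, hyS, ?_⟩
      by_contra hyi
      exact hdisj y hyS ⟨hy, hyi⟩
  obtain ⟨R, hR⟩ := (isBounded_iff_forall_norm_le.1 hB)
  have hv' : 0 < ‖v‖ := norm_pos_iff.2 hv
  have hR0 : 0 ≤ R := (norm_nonneg _).trans (hR y (interior_subset (hsub hyS)))
  set t : ℝ := (R + ‖y‖ + 1) / ‖v‖ with ht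
  have ht0 : 0 ≤ t := by positivity
  have h1 := hR _ (interior_subset (hsub ⟨t, ht0, rfl⟩))
  have h2 : ‖t • v‖ = R + ‖y‖ + 1 := by
    rw [norm_smul, Real.norm_of_nonneg ht0, ht, div_mul_cancel₀ _ hv'.ne']
  have h3 : ‖t • v‖ ≤ ‖y + t • v‖ + ‖y‖ := by
    simpa using norm_sub_le (y + t • v) y
  linarith

/-- An open convex set has an outer normal at every point outside of it. -/
theorem exists_inner_lt_of_notMem [CompleteSpace V] {A : Set V} (hA : Convex ℝ A) (hAo : IsOpen A)
    {y : V} (hy : y ∉ A) : ∃ v : V, ∀ a ∈ A, inner ℝ v a < inner ℝ v y := by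
  obtain ⟨f, hf⟩ := geometric_hahn_banach_open_point hA hAo hy
  refine ⟨(InnerProductSpace.toDual ℝ V).symm f, fun a ha => ?_⟩
  simpa using hf a ha

/-- Monotonicity of the Hausdorff measure of the boundary of convex sets. -/
theorem hausdorffMeasure_frontier_le_of_convex [CompleteSpace V] [MeasurableSpace V] [BorelSpace V]
    {A B : Set V} {d : ℝ} (hd : 0 ≤ d) (hA : Convex ℝ A) (hAo : IsOpen A) (hne : A.Nonempty)
    (hAB : A ⊆ B) (hB : IsBounded B) : μH[d] (frontier A) ≤ μH[d] (frontier B) := by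
  have key : ∀ y : frontier A, ∃ w : V,
      (∀ a ∈ closure A, inner ℝ w a ≤ inner ℝ w (y : V)) ∧ (y : V) + w ∈ frontier B := by
    rintro ⟨y, hy⟩
    have hyA : y ∉ A := fun h => hy.2 (hAo.interior_eq.symm ▸ h)
    obtain ⟨v, hv⟩ := exists_inner_lt_of_notMem hA hAo hyA
    have hv0 : v ≠ 0 := by
      rintro rfl
      obtain ⟨a, ha⟩ := hne
      simpa using hv a ha
    obtain ⟨t, ht, htB⟩ := exists_add_smul_mem_frontier hB (closure_mono hAB hy.1) hv0
    refine ⟨t • v, fun a ha => ?_, htB⟩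
    have hcl : closure A ⊆ {a | inner ℝ v a ≤ inner ℝ v y} :=
      closure_minimal (fun a ha => (hv a ha).le)
        (isClosed_le (by fun_prop) continuous_const)
    simpa only [real_inner_smul_left] using mul_le_mul_of_nonneg_left (hcl ha) ht
  choose w hw hwB using key
  have hanti : AntilipschitzWith 1 (fun y : frontier A => (y : V) + w y) := by
    refine AntilipschitzWith.of_le_mul_dist fun y z => ?_
    have h1 := hw y z z.2.1
    have h2 := hw z y y.2.1
    rw [NNReal.coe_one, one_mul, Subtype.dist_eq, dist_eq_norm, dist_eq_norm]
    refine le_of_sq_le_sq ?_ (norm_nonneg _)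
    have h3 : (y : V) + w y - ((z : V) + w z) = ((y : V) - z) + (w y - w z) := by abel
    rw [h3, norm_add_sq_real]
    have h4 : 0 ≤ inner ℝ ((y : V) - z) (w y - w z) := by
      rw [real_inner_comm, inner_sub_left, inner_sub_right, inner_sub_right]
      linarith
    nlinarith [sq_nonneg ‖w y - w z‖]
  calc μH[d] (frontier A) = μH[d] ((↑) '' (univ : Set (frontier A)) : Set V) := by simp
    _ = μH[d] (univ : Set (frontier A)) :=
        isometry_subtype_coe.hausdorffMeasure_image (Or.inl hd) _
    _ ≤ μH[d] ((fun y : frontier A => (y : V) + w y) '' univ) := by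
        simpa using hanti.le_hausdorffMeasure_image hd univ
    _ ≤ μH[d] (frontier B) := by
        refine measure_mono ?_
        rintro _ ⟨y, -, rfl⟩
        exact hwB y

/-- If a ball is at Hausdorff distance `d` from a convex set, then the concentric ball of radius
smaller by `d` is contained in the set. -/
theorem ball_sub_hausdorffDist_subset [CompleteSpace V] {E : Set V} (hE : Convex ℝ E)
    (hEo : IsOpen E) (hEb : IsBounded E) (hne : E.Nonempty) {x : V} {s : ℝ} (hs : 0 < s) :
    ball x (s - hausdorffDist E (ball x s)) ⊆ E := by
  intro y hy
  by_contra hyE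
  set d := hausdorffDist E (ball x s) with hd
  have hd0 : 0 ≤ d := hausdorffDist_nonneg
  obtain ⟨v, hv⟩ := exists_inner_lt_of_notMem hE hEo hyE
  have hv0 : v ≠ 0 := by
    rintro rfl
    obtain ⟨a, ha⟩ := hne
    simpa using hv a ha
  have hvn : 0 < ‖v‖ := norm_pos_iff.2 hv0
  rw [mem_ball] at hy
  obtain ⟨e, he0, he⟩ : ∃ e, d < e ∧ dist y x + e < s :=
    ⟨(d + (s - dist y x)) / 2, by linarith, by linarith⟩
  have hz : y + (e / ‖v‖) • v ∈ ball x s := by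
    rw [mem_ball]
    have h1 : dist (y + (e / ‖v‖) • v) y = e := by
      rw [dist_eq_norm, add_sub_cancel_left, norm_smul,
        Real.norm_of_nonneg (div_nonneg (hd0.trans he0.le) hvn.le), div_mul_cancel₀ _ hvn.ne']
    linarith [dist_triangle (y + (e / ‖v‖) • v) y x]
  obtain ⟨a, ha, haz⟩ := exists_dist_lt_of_hausdorffDist_lt' hz (hd ▸ he0)
    (hausdorffEDist_ne_top_of_nonempty_of_bounded hne (nonempty_ball.2 hs) hEb isBounded_ball)
  have h2 : inner ℝ v (y + (e / ‖v‖) • v - a) = (inner ℝ v y - inner ℝ v a) + e * ‖v‖ := by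
    rw [inner_sub_right, inner_add_right, real_inner_smul_right, real_inner_self_eq_norm_sq]
    field_simp
    ring
  have h3 := real_inner_le_norm v (y + (e / ‖v‖) • v - a)
  rw [dist_comm, dist_eq_norm] at haz
  nlinarith [hv a ha]

theorem hausdorffDist_ball_le (x : V) {r s : ℝ} (hr : 0 < r) (hs : 0 < s) :
    hausdorffDist (ball x r) (ball x s) ≤ |r - s| := by
  have key : ∀ {r s : ℝ}, 0 < r → 0 < s → ∀ y ∈ ball x r, ∃ z ∈ ball x s, dist y z ≤ |r - s| := by
    intro r s hr hs y hy
    have hy' : ‖y - x‖ < r := by rwa [← dist_eq_norm]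
    refine ⟨x + (s / r) • (y - x), ?_, ?_⟩
    · rw [mem_ball, dist_eq_norm, add_sub_cancel_left, norm_smul,
        Real.norm_of_nonneg (by positivity), div_mul_eq_mul_div, div_lt_iff₀ hr]
      gcongr
    · have h1 : y - (x + (s / r) • (y - x)) = ((r - s) / r) • (y - x) := by
        rw [sub_div, div_self hr.ne', sub_smul, one_smul]
        abel
      rw [dist_eq_norm, h1, norm_smul, norm_div, Real.norm_eq_abs, Real.norm_of_nonneg hr.le,
        div_mul_eq_mul_div, div_le_iff₀ hr]
      gcongr
  refine hausdorffDist_le_of_mem_dist (abs_nonneg _) (key hr hs) ?_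
  rw [abs_sub_comm]
  exact key hs hr

theorem hausdorffMeasure_frontier_ball [Nontrivial V] [MeasurableSpace V] [BorelSpace V] {d : ℝ}
    (hd : 0 ≤ d) (x : V) {r : ℝ} (hr : 0 < r) :
    μH[d] (frontier (ball x r)) = ENNReal.ofReal (r ^ d) * μH[d] (sphere (0 : V) 1) := by
  have h1 : sphere x r = x +ᵥ r • sphere (0 : V) 1 := by
    rw [_root_.smul_sphere _ _ zero_le_one]
    simp [abs_of_pos hr]
  rw [frontier_ball x hr.ne', h1, hausdorffMeasure_vadd x (Or.inl hd),
    Measure.hausdorffMeasure_smul₀ hd hr.ne', ENNReal.smul_def, smul_eq_mul]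
  congr 1
  rw [← ENNReal.ofReal_rpow_of_pos hr, ENNReal.coe_rpow_of_nonneg _ hd, ← enorm_eq_nnnorm,
    Real.enorm_of_nonneg hr.le]

end ConvexPerimeter

/-- A convex set has the perimeter of some ball whose radius lies between the radii of any two
concentric balls, one contained in the set and the other containing it. -/
theorem exists_perim_ball_eq {n : ℕ} (hn : 2 ≤ n) {E : Set (EuclideanSpace ℝ (Fin n))}
    (hE : Convex ℝ E) (hEo : IsOpen E) (hEb : IsBounded E) (hne : E.Nonempty)
    (x : EuclideanSpace ℝ (Fin n)) {s d : ℝ} (hs : 0 < s) (hd : 0 ≤ d)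
    (hin : ball x (s - d) ⊆ E) (hout : ∀ R, s + d < R → E ⊆ ball x R) :
    ∃ ρ : ℝ, 0 < ρ ∧ perim n (ball x ρ) = perim n E ∧ |s - ρ| ≤ d := by
  have hn' : (2 : ℝ) ≤ n := by exact_mod_cast hn
  have hk : 0 < (n : ℝ) - 1 := by linarith
  have : Nonempty (Fin n) := ⟨⟨0, by omega⟩⟩
  have hball : ∀ (y : EuclideanSpace ℝ (Fin n)) {r : ℝ}, 0 < r →
      μH[(n : ℝ) - 1] (frontier (ball y r)) = ENNReal.ofReal (r ^ ((n : ℝ) - 1)) *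
        μH[(n : ℝ) - 1] (sphere (0 : EuclideanSpace ℝ (Fin n)) 1) :=
    fun y r hr => hausdorffMeasure_frontier_ball hk.le y hr
  have hle : ∀ {y : EuclideanSpace ℝ (Fin n)} {R : ℝ}, E ⊆ ball y R →
      μH[(n : ℝ) - 1] (frontier E) ≤ μH[(n : ℝ) - 1] (frontier (ball y R)) :=
    fun h => hausdorffMeasure_frontier_le_of_convex hk.le hE hEo hne h isBounded_ball
  have hge : ∀ {y : EuclideanSpace ℝ (Fin n)} {r : ℝ}, 0 < r → ball y r ⊆ E →
      μH[(n : ℝ) - 1] (frontier (ball y r)) ≤ μH[(n : ℝ) - 1] (frontier E) :=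
    fun hr h => hausdorffMeasure_frontier_le_of_convex hk.le (convex_ball _ _) isOpen_ball
      (nonempty_ball.2 hr) h hEb
  set M := μH[(n : ℝ) - 1] (sphere (0 : EuclideanSpace ℝ (Fin n)) 1)
  set P := μH[(n : ℝ) - 1] (frontier E)
  have hR := hle (hout (s + d + 1) (by linarith))
  rw [hball x (by linarith)] at hR
  obtain ⟨y, hy⟩ := hne
  obtain ⟨r, hr, hrE⟩ := Metric.isOpen_iff.1 hEo y hy
  have hr' := hge hr hrE
  rw [hball y hr] at hr'
  have hrpos : ENNReal.ofReal (r ^ ((n : ℝ) - 1)) ≠ 0 := by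
    simpa using Real.rpow_pos_of_pos hr _
  have hperim : ∀ {ρ : ℝ}, 0 < ρ → perim n (ball x ρ) = ρ ^ ((n : ℝ) - 1) * M.toReal := by
    intro ρ hρ
    rw [perim, hball x hρ, ENNReal.toReal_mul, ENNReal.toReal_ofReal (by positivity)]
  have hperimE : perim n E = P.toReal := rfl
  rcases eq_or_ne M 0 with h0 | h0
  · have hP0 : P = 0 := by simpa [h0] using hR
    exact ⟨s, hs, by rw [hperim hs, hperimE, h0, hP0]; simp, by simpa using hd⟩
  rcases eq_or_ne M ⊤ with htop | htop
  · have hPt : P = ⊤ := by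
      rw [htop, ENNReal.mul_top hrpos] at hr'
      exact top_le_iff.1 hr'
    exact ⟨s, hs, by rw [hperim hs, hperimE, htop, hPt]; simp, by simpa using hd⟩
  have hPt : P ≠ ⊤ := ne_top_of_le_ne_top (ENNReal.mul_ne_top ENNReal.ofReal_ne_top htop) hR
  have hP0 : P ≠ 0 := fun h => mul_ne_zero hrpos h0 (le_zero_iff.1 (h ▸ hr'))
  have hMpos : 0 < M.toReal := ENNReal.toReal_pos h0 htop
  have hPpos : 0 < P.toReal := ENNReal.toReal_pos hP0 hPt
  set ρ : ℝ := (P.toReal / M.toReal) ^ ((n : ℝ) - 1)⁻¹ with hρ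
  have hρ0 : 0 < ρ := by positivity
  have hρk : ρ ^ ((n : ℝ) - 1) * M.toReal = P.toReal := by
    rw [hρ, Real.rpow_inv_rpow (by positivity) hk.ne', div_mul_cancel₀ _ hMpos.ne']
  refine ⟨ρ, hρ0, by rw [hperim hρ0, hρk, hperimE], abs_le.2 ⟨?_, ?_⟩⟩
  · suffices ρ ≤ s + d by linarith
    refine le_of_forall_gt_imp_ge_of_dense fun R hR => ?_
    have hR0 : 0 < R := by linarith
    have h1 := ENNReal.toReal_mono (by rw [hball x hR0]; finiteness) (hle (hout R hR))
    change _ ≤ perim n (ball x R) at h1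
    rw [hperim hR0, ← hρk] at h1
    exact (Real.rpow_le_rpow_iff hρ0.le hR0.le hk).1 (le_of_mul_le_mul_right h1 hMpos)
  · suffices s - d ≤ ρ by linarith
    rcases le_or_gt (s - d) 0 with h | h
    · linarith
    have h1 := ENNReal.toReal_mono hPt (hge h hin)
    change perim n (ball x (s - d)) ≤ _ at h1
    rw [hperim h, ← hρk] at h1
    exact (Real.rpow_le_rpow_iff h.le hρ0.le hk).1 (le_of_mul_le_mul_right h1 hMpos)

/-- **Lemma 2.3:** comparison of the two Hausdorff asymmetry indices. -/
theorem stmt7 {n : ℕ} (hn : 2 ≤ n) :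
    ∃ δ C : ℝ, 0 < δ ∧ 0 < C ∧
      ∀ (E : Set (EuclideanSpace ℝ (Fin n))) (x : EuclideanSpace ℝ (Fin n)) (r : ℝ),
        IsOpen E → IsBounded E → Convex ℝ E → E.Nonempty →
        0 < r → volume (ball x r) = volume E →
        perim n E - perim n (ball x r) ≤ δ →
        AHstar n E ≤ C * AHsharp n E := by
  refine ⟨1, 2, one_pos, two_pos, fun E x r hEo hEb hE hne hr hvol _ => ?_⟩
  suffices AHstar n E / 2 ≤ AHsharp n E by linarith
  refine le_csInf ⟨_, x, r, hr, hvol, rfl⟩ ?_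
  rintro _ ⟨y, s, hs, -, rfl⟩
  have hfin : hausdorffEDist E (ball y s) ≠ ⊤ :=
    hausdorffEDist_ne_top_of_nonempty_of_bounded hne (nonempty_ball.2 hs) hEb isBounded_ball
  have hout : ∀ R, s + hausdorffDist E (ball y s) < R → E ⊆ ball y R := by
    intro R hR a ha
    obtain ⟨b, hb, hab⟩ := exists_dist_lt_of_hausdorffDist_lt ha
      (show hausdorffDist E (ball y s) < R - s by linarith) hfin
    rw [mem_ball] at hb ⊢
    linarith [dist_triangle a b y]
  obtain ⟨ρ, hρ, hperim, hsρ⟩ := exists_perim_ball_eq hn hE hEo hEb hne y hs hausdorffDist_nonneg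
    (ball_sub_hausdorffDist_subset hE hEo hEb hne hs) hout
  have h1 : AHstar n E ≤ hausdorffDist E (ball y ρ) := by
    refine csInf_le ⟨0, ?_⟩ ⟨y, ρ, hρ, hperim, rfl⟩
    rintro _ ⟨_, _, _, _, rfl⟩
    exact hausdorffDist_nonneg
  linarith [hausdorffDist_triangle (u := ball y ρ) hfin, hausdorffDist_ball_le y hs hρ]
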